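/- Let A be a real m × n matrix with every entry strictly positive, and let B be a real m × n matrix with rank(B) ≤ 1 that minimizes ‖C − A‖_F over all real m × n matrices C with rank(C) ≤ 1. Then every entry of B is nonnegative, i.e., B equals its entrywise absolute value |B|. -/

import Mathlib

/-- The Frobenius norm of a real `m × n` matrix: `‖M‖_F = sqrt (∑ i j, (M i j)²)`. -/
noncomputable def frobeniusNorm {m n : ℕ} (M : Matrix (Fin m) (Fin n) ℝ) : ℝ :=
  Real.sqrt (∑ i, ∑ j, (M i j) ^ 2)

theorem Matrix.exists_eq_vecMulVec_of_rank_le_one {m n K : Type*} [Fintype n] [Field K]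
    {M : Matrix m n K} (hM : M.rank ≤ 1) :
    ∃ (u : m → K) (v : n → K), M = Matrix.vecMulVec u v := by
  classical
  obtain ⟨⟨u, _⟩, hu⟩ := finrank_le_one_iff.1 hM
  choose c hc using fun j => hu ⟨M.mulVec (Pi.single j 1), Pi.single j 1, rfl⟩
  refine ⟨u, c, ?_⟩
  ext i j
  have h := congrFun (congrArg Subtype.val (hc j)) i
  simp only [SetLike.val_smul, Pi.smul_apply, smul_eq_mul, Matrix.mulVec_single_one,
    Matrix.col_apply] at h
  rw [Matrix.vecMulVec_apply, mul_comm, h]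

theorem Matrix.rank_abs_le_one {m n K : Type*} [Fintype n] [Field K] [LinearOrder K]
    [IsStrictOrderedRing K] {M : Matrix m n K} (hM : M.rank ≤ 1) :
    (Matrix.of fun i j => |M i j|).rank ≤ 1 := by
  obtain ⟨u, v, rfl⟩ := Matrix.exists_eq_vecMulVec_of_rank_le_one hM
  have h : (Matrix.of fun i j => |Matrix.vecMulVec u v i j|) =
      Matrix.vecMulVec (fun i => |u i|) (fun j => |v j|) := by
    ext i j
    simp [Matrix.vecMulVec_apply, abs_mul]
  rw [h]
  exact Matrix.rank_vecMulVec_le _ _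

theorem sq_abs_sub_le_sq_sub {a : ℝ} (ha : 0 ≤ a) (b : ℝ) : (|b| - a) ^ 2 ≤ (b - a) ^ 2 := by
  nlinarith [sq_abs b, mul_le_mul_of_nonneg_left (le_abs_self b) ha]

/-- If every entry of `A` is strictly positive and `B` with
`rank B ≤ 1` minimizes `‖C - A‖_F` over all matrices `C` with `rank C ≤ 1`, then
every entry of `B` is nonnegative, i.e. `B` equals its entrywise absolute value. -/
theorem stmt_11 {m n : ℕ} (A B : Matrix (Fin m) (Fin n) ℝ)
    (hA : ∀ i j, 0 < A i j) (hB : B.rank ≤ 1)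
    (hmin : ∀ C : Matrix (Fin m) (Fin n) ℝ, C.rank ≤ 1 →
      frobeniusNorm (B - A) ≤ frobeniusNorm (C - A)) :
    B = Matrix.of fun i j => |B i j| := by
  have hle : ∑ i, ∑ j, (B i j - A i j) ^ 2 ≤ ∑ i, ∑ j, (|B i j| - A i j) ^ 2 :=
    (Real.sqrt_le_sqrt_iff (by positivity)).1 (hmin _ (Matrix.rank_abs_le_one hB))
  have hterm i j : (|B i j| - A i j) ^ 2 ≤ (B i j - A i j) ^ 2 :=
    sq_abs_sub_le_sq_sub (hA i j).le (B i j)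
  have hrow i : ∑ j, (|B i j| - A i j) ^ 2 ≤ ∑ j, (B i j - A i j) ^ 2 :=
    Finset.sum_le_sum fun j _ => hterm i j
  have heq := (Finset.sum_eq_sum_iff_of_le fun i _ => hrow i).1
    (le_antisymm (Finset.sum_le_sum fun i _ => hrow i) hle)
  ext i j
  have h := (Finset.sum_eq_sum_iff_of_le fun j _ => hterm i j).1
    (heq i (Finset.mem_univ i)) j (Finset.mem_univ j)
  have hmul : A i j * B i j = A i j * |B i j| := by nlinarith [sq_abs (B i j)]
  exact mul_left_cancel₀ (hA i j).ne' hmul
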